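/- Fix a real σ > 0, an integer M ≥ 2, and a desired signal amplitude μ ≥ 0. Over all vectors a = (a₁, …, a_{M−1}) of nonnegative interference amplitudes, the conditional correct detection probability P_c(μ, a) = ∫_0^∞ f(r; μ, σ) · ∏_{j=1}^{M−1} (1 − Q₁(a_j/σ, r/σ)) dr is maximized exactly at a = 0: for every a, P_c(μ, a) ≤ P_c*(μ) := ∫_0^∞ f(r; μ, σ) · (1 − exp(−r²/(2σ²)))^{M−1} dr, with equality if and only if a_j = 0 for all j ∈ {1, …, M−1}. -/

import Mathlib

open MeasureTheory

/-- Modified Bessel function of the first kind of order zero, via its power series. -/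
noncomputable def besselI0 (x : ℝ) : ℝ :=
  ∑' k : ℕ, (x / 2) ^ (2 * k) / ((Nat.factorial k : ℝ)) ^ 2

/-- First-order Marcum Q-function. -/
noncomputable def marcumQ1 (a b : ℝ) : ℝ :=
  ∫ x in Set.Ioi b, x * Real.exp (-(x ^ 2 + a ^ 2) / 2) * besselI0 (a * x)

/-- Rician probability density with noncentrality `μ` and scale `σ`. -/
noncomputable def ricePdf (σ μ r : ℝ) : ℝ :=
  (r / σ ^ 2) * Real.exp (-(r ^ 2 + μ ^ 2) / (2 * σ ^ 2)) * besselI0 (r * μ / σ ^ 2)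

/-- Conditional correct detection probability. -/
noncomputable def Pc (σ : ℝ) (M : ℕ) (μ : ℝ) (a : Fin (M - 1) → ℝ) : ℝ :=
  ∫ r in Set.Ioi (0 : ℝ), ricePdf σ μ r * ∏ j, (1 - marcumQ1 (a j / σ) (r / σ))

/-- The interference-free CCDP (its maximum value). -/
noncomputable def PcStar (σ : ℝ) (M : ℕ) (μ : ℝ) : ℝ :=
  ∫ r in Set.Ioi (0 : ℝ),
    ricePdf σ μ r * (1 - Real.exp (-r ^ 2 / (2 * σ ^ 2))) ^ (M - 1)

/-- The regularized upper incomplete gamma function `Γ(k + 1, b² / 2) / k!` in closed form. -/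
noncomputable def poissonTail (k : ℕ) (b : ℝ) : ℝ :=
  Real.exp (-b ^ 2 / 2) * ∑ i ∈ Finset.range (k + 1), (b ^ 2 / 2) ^ i / (Nat.factorial i : ℝ)

theorem hasDerivAt_neg_poissonTail (k : ℕ) (x : ℝ) :
    HasDerivAt (fun y => -poissonTail k y)
      (x * Real.exp (-x ^ 2 / 2) * ((x ^ 2 / 2) ^ k / (Nat.factorial k : ℝ))) x := by
  have hexp : HasDerivAt (fun y : ℝ => Real.exp (-y ^ 2 / 2)) (-x * Real.exp (-x ^ 2 / 2)) x := by
    refine (((hasDerivAt_pow 2 x).fun_neg).div_const 2).exp.congr_deriv ?_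
    push_cast; ring
  induction k with
  | zero =>
    have h : (fun y => -poissonTail 0 y) = fun y : ℝ => -Real.exp (-y ^ 2 / 2) := by
      ext y; simp [poissonTail]
    rw [h]
    exact hexp.fun_neg.congr_deriv (by simp)
  | succ k ih =>
    have hpow : HasDerivAt (fun y : ℝ => (y ^ 2 / 2) ^ (k + 1) / (Nat.factorial (k + 1) : ℝ))
        (x * ((x ^ 2 / 2) ^ k / (Nat.factorial k : ℝ))) x := by
      refine (((((hasDerivAt_pow 2 x).div_const 2).fun_pow (k + 1))).div_const
        (Nat.factorial (k + 1) : ℝ)).congr_deriv ?_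
      rw [Nat.factorial_succ]
      have : (Nat.factorial k : ℝ) ≠ 0 := by positivity
      have : (k : ℝ) + 1 ≠ 0 := by positivity
      push_cast
      field_simp
    have h : (fun y => -poissonTail (k + 1) y) = fun y : ℝ => -poissonTail k y -
        Real.exp (-y ^ 2 / 2) * ((y ^ 2 / 2) ^ (k + 1) / (Nat.factorial (k + 1) : ℝ)) := by
      ext y
      rw [poissonTail, Finset.sum_range_succ _ (k + 1), poissonTail]
      ring
    rw [h]
    exact (ih.fun_sub (hexp.fun_mul hpow)).congr_deriv (by ring)

theorem tendsto_poissonTail (k : ℕ) :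
    Filter.Tendsto (poissonTail k) Filter.atTop (nhds 0) := by
  have hsq : Filter.Tendsto (fun x : ℝ => x ^ 2 / 2) Filter.atTop Filter.atTop :=
    (Filter.tendsto_pow_atTop two_ne_zero).atTop_div_const two_pos
  have h : Filter.Tendsto
      (fun x : ℝ => ∑ i ∈ Finset.range (k + 1),
        (x ^ 2 / 2) ^ i * Real.exp (-(x ^ 2 / 2)) / (Nat.factorial i : ℝ))
      Filter.atTop (nhds (∑ i ∈ Finset.range (k + 1), 0 / (Nat.factorial i : ℝ))) :=
    tendsto_finsetSum _ fun i _ =>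
      ((Real.tendsto_pow_mul_exp_neg_atTop_nhds_zero i).comp hsq).div_const _
  simp only [zero_div, Finset.sum_const_zero] at h
  refine h.congr fun x => ?_
  rw [poissonTail, Finset.mul_sum]
  refine Finset.sum_congr rfl fun i _ => ?_
  rw [neg_div]; ring

theorem integrableOn_and_integral_poissonTail (k : ℕ) {b : ℝ} (hb : 0 ≤ b) :
    IntegrableOn (fun x : ℝ =>
      x * Real.exp (-x ^ 2 / 2) * ((x ^ 2 / 2) ^ k / (Nat.factorial k : ℝ))) (Set.Ioi b) ∧
    ∫ x in Set.Ioi b, x * Real.exp (-x ^ 2 / 2) * ((x ^ 2 / 2) ^ k / (Nat.factorial k : ℝ)) =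
      poissonTail k b := by
  have hderiv : ∀ x ∈ Set.Ici b, HasDerivAt (fun y => -poissonTail k y)
      (x * Real.exp (-x ^ 2 / 2) * ((x ^ 2 / 2) ^ k / (Nat.factorial k : ℝ))) x :=
    fun x _ => hasDerivAt_neg_poissonTail k x
  have hpos : ∀ x ∈ Set.Ioi b,
      0 ≤ x * Real.exp (-x ^ 2 / 2) * ((x ^ 2 / 2) ^ k / (Nat.factorial k : ℝ)) := by
    intro x hx
    have : 0 < x := hb.trans_lt hx
    positivity
  have hlim : Filter.Tendsto (fun y => -poissonTail k y) Filter.atTop (nhds 0) := by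
    simpa using (tendsto_poissonTail k).neg
  refine ⟨integrableOn_Ioi_deriv_of_nonneg' hderiv hpos hlim, ?_⟩
  rw [integral_Ioi_of_hasDerivAt_of_nonneg' hderiv hpos hlim]
  ring

theorem exp_le_poissonTail (k : ℕ) (b : ℝ) : Real.exp (-b ^ 2 / 2) ≤ poissonTail k b := by
  rw [poissonTail, Finset.sum_range_succ']
  refine le_mul_of_one_le_right (Real.exp_pos _).le ?_
  have : 0 ≤ ∑ i ∈ Finset.range k, (b ^ 2 / 2) ^ (i + 1) / (Nat.factorial (i + 1) : ℝ) :=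
    Finset.sum_nonneg fun i _ => by positivity
  simpa using this

theorem exp_lt_poissonTail_one {b : ℝ} (hb : 0 < b) :
    Real.exp (-b ^ 2 / 2) < poissonTail 1 b := by
  rw [poissonTail]
  refine lt_mul_of_one_lt_right (Real.exp_pos _) ?_
  simp [Finset.sum_range_succ]
  positivity

theorem poissonTail_le_one (k : ℕ) (b : ℝ) : poissonTail k b ≤ 1 := by
  have h := Real.sum_le_exp_of_nonneg (x := b ^ 2 / 2) (by positivity) (k + 1)
  calc poissonTail k b ≤ Real.exp (-b ^ 2 / 2) * Real.exp (b ^ 2 / 2) :=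
        mul_le_mul_of_nonneg_left h (Real.exp_pos _).le
    _ = 1 := by rw [← Real.exp_add]; simp [neg_div]

theorem poissonTail_zero_right (k : ℕ) : poissonTail k 0 = 1 := by
  simp [poissonTail, Finset.sum_range_succ']

theorem summable_besselI0 (x : ℝ) :
    Summable fun k : ℕ => (x / 2) ^ (2 * k) / ((Nat.factorial k : ℝ)) ^ 2 := by
  refine Summable.of_nonneg_of_le (fun k => ?_) (fun k => ?_)
    (Real.summable_pow_div_factorial ((x / 2) ^ 2))
  · rw [pow_mul]; positivity
  · rw [pow_mul]
    have h : (1 : ℝ) ≤ Nat.factorial k := by exact_mod_cast k.factorial_pos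
    gcongr
    nlinarith

theorem besselI0_pos (x : ℝ) : 0 < besselI0 x := by
  refine (summable_besselI0 x).tsum_pos (fun k => ?_) 0 (by simp)
  rw [pow_mul]; positivity

/-- The Poisson weight of parameter `a² / 2`. -/
noncomputable def poissonWeight (a : ℝ) (k : ℕ) : ℝ :=
  Real.exp (-a ^ 2 / 2) * ((a ^ 2 / 2) ^ k / (Nat.factorial k : ℝ))

theorem poissonWeight_nonneg (a : ℝ) (k : ℕ) : 0 ≤ poissonWeight a k := by
  unfold poissonWeight; positivity

theorem poissonWeight_pos {a : ℝ} (ha : a ≠ 0) (k : ℕ) : 0 < poissonWeight a k := by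
  unfold poissonWeight; positivity

theorem hasSum_poissonWeight (a : ℝ) : HasSum (poissonWeight a) 1 := by
  have h := (NormedSpace.expSeries_div_hasSum_exp (a ^ 2 / 2)).mul_left (Real.exp (-a ^ 2 / 2))
  rw [← Real.exp_eq_exp_ℝ, ← Real.exp_add] at h
  have hone : Real.exp (-a ^ 2 / 2 + a ^ 2 / 2) = 1 := by simp [neg_div]
  rwa [hone] at h

theorem summable_poissonWeight_mul_poissonTail (a b : ℝ) :
    Summable fun k => poissonWeight a k * poissonTail k b := by
  refine Summable.of_nonneg_of_le (fun k => ?_) (fun k => ?_) (hasSum_poissonWeight a).summable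
  · exact mul_nonneg (poissonWeight_nonneg a k) ((Real.exp_pos _).le.trans (exp_le_poissonTail k b))
  · exact mul_le_of_le_one_right (poissonWeight_nonneg a k) (poissonTail_le_one k b)

theorem riceKernel_eq_tsum (a x : ℝ) :
    x * Real.exp (-(x ^ 2 + a ^ 2) / 2) * besselI0 (a * x) =
      ∑' k, poissonWeight a k *
        (x * Real.exp (-x ^ 2 / 2) * ((x ^ 2 / 2) ^ k / (Nat.factorial k : ℝ))) := by
  rw [besselI0, ← tsum_mul_left]
  refine tsum_congr fun k => ?_
  have h1 : Real.exp (-(x ^ 2 + a ^ 2) / 2) = Real.exp (-x ^ 2 / 2) * Real.exp (-a ^ 2 / 2) := by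
    rw [← Real.exp_add]; ring_nf
  have h2 : (a * x / 2) ^ (2 * k) = (a ^ 2 / 2) ^ k * (x ^ 2 / 2) ^ k := by
    rw [pow_mul, ← mul_pow]; ring_nf
  rw [h1, h2, poissonWeight]
  field_simp

theorem marcumQ1_eq_tsum (a : ℝ) {b : ℝ} (hb : 0 ≤ b) :
    marcumQ1 a b = ∑' k, poissonWeight a k * poissonTail k b := by
  have hint := fun k => integrableOn_and_integral_poissonTail k hb
  have hnorm : ∀ k, ∫ x in Set.Ioi b, ‖poissonWeight a k *
      (x * Real.exp (-x ^ 2 / 2) * ((x ^ 2 / 2) ^ k / (Nat.factorial k : ℝ)))‖ =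
        poissonWeight a k * poissonTail k b := by
    intro k
    rw [← (hint k).2, ← integral_const_mul]
    refine setIntegral_congr_fun measurableSet_Ioi fun x hx => ?_
    have hx0 : 0 < x := hb.trans_lt hx
    have := poissonWeight_nonneg a k
    exact Real.norm_of_nonneg (by positivity)
  have h := hasSum_integral_of_summable_integral_norm (μ := volume.restrict (Set.Ioi b))
    (F := fun k x => poissonWeight a k *
      (x * Real.exp (-x ^ 2 / 2) * ((x ^ 2 / 2) ^ k / (Nat.factorial k : ℝ))))
    (fun k => (hint k).1.const_mul _)
    (by simpa only [hnorm] using summable_poissonWeight_mul_poissonTail a b)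
  simp only [← riceKernel_eq_tsum] at h
  rw [marcumQ1, ← h.tsum_eq]
  exact tsum_congr fun k => by rw [integral_const_mul, (hint k).2]

theorem marcumQ1_zero_right (a : ℝ) : marcumQ1 a 0 = 1 := by
  simp [marcumQ1_eq_tsum a le_rfl, poissonTail_zero_right, (hasSum_poissonWeight a).tsum_eq]

theorem marcumQ1_zero_left {b : ℝ} (hb : 0 ≤ b) : marcumQ1 0 b = Real.exp (-b ^ 2 / 2) := by
  rw [marcumQ1_eq_tsum 0 hb, tsum_eq_single 0]
  · simp [poissonWeight, poissonTail]
  · intro k hk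
    simp [poissonWeight, hk]

theorem exp_le_marcumQ1 (a : ℝ) {b : ℝ} (hb : 0 ≤ b) :
    Real.exp (-b ^ 2 / 2) ≤ marcumQ1 a b := by
  have h := (hasSum_poissonWeight a).mul_right (Real.exp (-b ^ 2 / 2))
  rw [marcumQ1_eq_tsum a hb, ← one_mul (Real.exp _), ← h.tsum_eq]
  exact h.summable.tsum_le_tsum
    (fun k => mul_le_mul_of_nonneg_left (exp_le_poissonTail k b) (poissonWeight_nonneg a k))
    (summable_poissonWeight_mul_poissonTail a b)

theorem exp_lt_marcumQ1 {a b : ℝ} (ha : a ≠ 0) (hb : 0 < b) :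
    Real.exp (-b ^ 2 / 2) < marcumQ1 a b := by
  have h := (hasSum_poissonWeight a).mul_right (Real.exp (-b ^ 2 / 2))
  rw [marcumQ1_eq_tsum a hb.le, ← one_mul (Real.exp _), ← h.tsum_eq]
  exact h.summable.tsum_lt_tsum
    (fun k => mul_le_mul_of_nonneg_left (exp_le_poissonTail k b) (poissonWeight_nonneg a k))
    (mul_lt_mul_of_pos_left (exp_lt_poissonTail_one hb) (poissonWeight_pos ha 1))
    (summable_poissonWeight_mul_poissonTail a b)

theorem marcumQ1_lt_one (a : ℝ) {b : ℝ} (hb : 0 < b) : marcumQ1 a b < 1 := by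
  rw [marcumQ1_eq_tsum a hb.le, ← (hasSum_poissonWeight a).tsum_eq]
  refine (summable_poissonWeight_mul_poissonTail a b).tsum_lt_tsum (i := 0)
    (fun k => mul_le_of_le_one_right (poissonWeight_nonneg a k) (poissonTail_le_one k b))
    (mul_lt_of_lt_one_right ?_ ?_) (hasSum_poissonWeight a).summable
  · simp [poissonWeight, Real.exp_pos]
  · simp only [poissonTail, zero_add, Finset.sum_range_one, pow_zero, Nat.factorial_zero,
      Nat.cast_one, div_one, mul_one]
    exact Real.exp_zero ▸ Real.exp_lt_exp.2 (by have := pow_pos hb 2; linarith)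

theorem integrableOn_riceKernel (a : ℝ) :
    IntegrableOn (fun x : ℝ => x * Real.exp (-(x ^ 2 + a ^ 2) / 2) * besselI0 (a * x))
      (Set.Ioi 0) := by
  by_contra h
  have h1 := marcumQ1_zero_right a
  rw [marcumQ1, integral_undef h] at h1
  exact zero_ne_one h1

theorem antitoneOn_marcumQ1 (a : ℝ) : AntitoneOn (marcumQ1 a) (Set.Ici 0) := by
  intro b hb c _ hbc
  refine setIntegral_mono_set
    ((integrableOn_riceKernel a).mono_set (Set.Ioi_subset_Ioi hb)) ?_
    (Set.Ioi_subset_Ioi hbc).eventuallyLE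
  filter_upwards [ae_restrict_mem measurableSet_Ioi] with x hx
  have hx0 : 0 < x := lt_of_le_of_lt hb hx
  have := besselI0_pos (a * x)
  simp only [Pi.zero_apply]
  positivity

theorem ricePdf_pos {σ : ℝ} (hσ : 0 < σ) (μ : ℝ) {r : ℝ} (hr : 0 < r) : 0 < ricePdf σ μ r := by
  have := besselI0_pos (r * μ / σ ^ 2)
  unfold ricePdf
  positivity

theorem integrableOn_ricePdf {σ : ℝ} (hσ : 0 < σ) (μ : ℝ) :
    IntegrableOn (ricePdf σ μ) (Set.Ioi 0) := by
  have h := (integrableOn_Ioi_comp_mul_right_iff _ 0 (inv_pos.2 hσ)).2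
    (by simpa only [zero_mul] using integrableOn_riceKernel (μ / σ))
  refine IntegrableOn.congr_fun (h.const_mul σ⁻¹) (fun r _ => ?_) measurableSet_Ioi
  have h1 : -((r * σ⁻¹) ^ 2 + (μ / σ) ^ 2) / 2 = -(r ^ 2 + μ ^ 2) / (2 * σ ^ 2) := by
    field_simp
  have h2 : μ / σ * (r * σ⁻¹) = r * μ / σ ^ 2 := by field_simp
  simp only [ricePdf, h1, h2]
  field_simp

theorem aestronglyMeasurable_marcumQ1 {σ : ℝ} (hσ : 0 < σ) (a : ℝ) :
    AEStronglyMeasurable (fun r => marcumQ1 a (r / σ)) (volume.restrict (Set.Ioi 0)) := by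
  refine (aemeasurable_restrict_of_antitoneOn measurableSet_Ioi
    fun r hr s hs hrs => ?_).aestronglyMeasurable
  exact antitoneOn_marcumQ1 a (div_nonneg (le_of_lt hr) hσ.le) (div_nonneg (le_of_lt hs) hσ.le)
    (by gcongr)

theorem integrableOn_Pc_integrand {σ : ℝ} (hσ : 0 < σ) {M : ℕ} (μ : ℝ) (a : Fin (M - 1) → ℝ) :
    IntegrableOn (fun r => ricePdf σ μ r * ∏ j, (1 - marcumQ1 (a j / σ) (r / σ)))
      (Set.Ioi 0) := by
  refine (integrableOn_ricePdf hσ μ).mul_bdd (c := 1) ?_ ?_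
  · exact Finset.aestronglyMeasurable_fun_prod _ fun j _ =>
      aestronglyMeasurable_const.sub (aestronglyMeasurable_marcumQ1 hσ (a j / σ))
  · filter_upwards [ae_restrict_mem measurableSet_Ioi] with r hr
    have hr' : 0 < r / σ := div_pos hr hσ
    have hQ := fun j => marcumQ1_lt_one (a j / σ) hr'
    rw [Real.norm_of_nonneg (Finset.prod_nonneg fun j _ => (sub_pos.2 (hQ j)).le)]
    refine Finset.prod_le_one (fun j _ => (sub_pos.2 (hQ j)).le) fun j _ => ?_
    linarith [exp_le_marcumQ1 (a j / σ) hr'.le, Real.exp_pos (-(r / σ) ^ 2 / 2)]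

theorem Pc_zero {σ : ℝ} (hσ : 0 < σ) (M : ℕ) (μ : ℝ) : Pc σ M μ 0 = PcStar σ M μ := by
  refine setIntegral_congr_fun measurableSet_Ioi fun r hr => ?_
  have h : -(r / σ) ^ 2 / 2 = -r ^ 2 / (2 * σ ^ 2) := by field_simp
  simp [marcumQ1_zero_left (div_nonneg (le_of_lt hr) hσ.le), h]

theorem prod_one_sub_marcumQ1_le {σ r : ℝ} (hr : 0 < r / σ) {n : ℕ} (a : Fin n → ℝ) :
    ∏ j, (1 - marcumQ1 (a j / σ) (r / σ)) ≤ ∏ _j : Fin n, (1 - marcumQ1 (0 / σ) (r / σ)) := by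
  refine Finset.prod_le_prod (fun j _ => (sub_pos.2 (marcumQ1_lt_one _ hr)).le) fun j _ => ?_
  rw [zero_div, marcumQ1_zero_left hr.le]
  exact sub_le_sub_left (exp_le_marcumQ1 _ hr.le) _

theorem prod_one_sub_marcumQ1_lt {σ r : ℝ} (hσ : 0 < σ) (hr : 0 < r / σ) {n : ℕ} {a : Fin n → ℝ}
    {i : Fin n} (hi : a i ≠ 0) :
    ∏ j, (1 - marcumQ1 (a j / σ) (r / σ)) < ∏ _j : Fin n, (1 - marcumQ1 (0 / σ) (r / σ)) := by
  refine Finset.prod_lt_prod (fun j _ => sub_pos.2 (marcumQ1_lt_one _ hr)) (fun j _ => ?_)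
    ⟨i, Finset.mem_univ i, ?_⟩
  · rw [zero_div, marcumQ1_zero_left hr.le]
    exact sub_le_sub_left (exp_le_marcumQ1 _ hr.le) _
  · rw [zero_div, marcumQ1_zero_left hr.le]
    exact sub_lt_sub_left (exp_lt_marcumQ1 (div_ne_zero hi hσ.ne') hr) _

/-- The CCDP is maximized exactly at zero interference amplitudes. -/
theorem Pc_le_PcStar_iff (σ : ℝ) (hσ : 0 < σ) (M : ℕ) (hM : 2 ≤ M)
    (μ : ℝ) (hμ : 0 ≤ μ) (a : Fin (M - 1) → ℝ) (ha : ∀ j, 0 ≤ a j) :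
    Pc σ M μ a ≤ PcStar σ M μ ∧ (Pc σ M μ a = PcStar σ M μ ↔ ∀ j, a j = 0) := by
  have hle : (fun r => ricePdf σ μ r * ∏ j, (1 - marcumQ1 (a j / σ) (r / σ)))
      ≤ᵐ[volume.restrict (Set.Ioi 0)]
      (fun r => ricePdf σ μ r * ∏ j, (1 - marcumQ1 ((0 : Fin (M - 1) → ℝ) j / σ) (r / σ))) := by
    filter_upwards [ae_restrict_mem measurableSet_Ioi] with r hr
    exact mul_le_mul_of_nonneg_left (prod_one_sub_marcumQ1_le (div_pos hr hσ) a)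
      (ricePdf_pos hσ μ hr).le
  have hint := integrableOn_Pc_integrand hσ μ a
  have hint0 := integrableOn_Pc_integrand hσ μ (0 : Fin (M - 1) → ℝ)
  rw [← Pc_zero hσ]
  refine ⟨integral_mono_ae hint hint0 hle, fun heq => ?_, fun h => by rw [funext h]; rfl⟩
  by_contra! hne
  obtain ⟨i, hi⟩ := hne
  have hae := (integral_eq_iff_of_ae_le hint hint0 hle).1 heq
  have hfalse : ∀ᵐ r ∂(volume.restrict (Set.Ioi (0 : ℝ))), False := by
    filter_upwards [hae, ae_restrict_mem measurableSet_Ioi] with r h hr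
    exact (mul_lt_mul_of_pos_left (prod_one_sub_marcumQ1_lt hσ (div_pos hr hσ) hi)
      (ricePdf_pos hσ μ hr)).ne h
  have hzero : volume.restrict (Set.Ioi (0 : ℝ)) = 0 :=
    ae_eq_bot.1 (Filter.eventually_false_iff_eq_bot.1 hfalse)
  simp at hzero
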